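/- Let d ≥ 1, s ∈ (0,1), ε > 0, R > 0, let G : ℝ^d → ℝ be measurable, and let h : ℝ^d → ℝ be measurable and bounded with h(y) = 0 for |y| > R. Then, as an inequality in [0,∞], ∬_{ℝ^d×ℝ^d} |G(x/ε) − G(y/ε)|² |h(y)|² |x−y|^{−d−2s} dx dy ≤ ε^{d−2s} ‖h‖_∞² ∫_{B(0,R/ε)} ( ∫_{ℝ^d} |G(y+z) − G(y)|² |z|^{−d−2s} dz ) dy. -/

import Mathlib

open MeasureTheory ENNReal

/-- Change of variables `x = ε x'` for the lower Lebesgue integral. -/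
lemma lintegral_comp_inv_smul {d : ℕ} {ε : ℝ} (hε : 0 < ε)
    (f : EuclideanSpace ℝ (Fin d) → ℝ≥0∞) :
    ∫⁻ x, f (ε⁻¹ • x) = ENNReal.ofReal (ε ^ d) * ∫⁻ x, f x := by
  have he : MeasurableEmbedding (fun x : EuclideanSpace ℝ (Fin d) => ε⁻¹ • x) :=
    (Homeomorph.smulOfNeZero ε⁻¹ (inv_ne_zero hε.ne')).measurableEmbedding
  rw [← he.lintegral_map, Measure.map_addHaar_smul _ (inv_ne_zero hε.ne'), lintegral_smul_measure,
    finrank_euclideanSpace_fin, inv_pow, inv_inv, abs_of_pos (pow_pos hε d), smul_eq_mul]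

/-- Scaling estimate for the weighted Gagliardo seminorm of a rescaled
function: the double integral against a bounded weight supported in `B(0,R)` is controlled
by `ε^{d-2s} ‖h‖_∞²` times the Gagliardo energy of `G` over the large ball `B(0,R/ε)`. -/
theorem rescaled_gagliardo_scaling
    (d : ℕ) (hd : 1 ≤ d) (s : ℝ) (hs : s ∈ Set.Ioo (0:ℝ) 1)
    (ε : ℝ) (hε : 0 < ε) (R : ℝ) (hR : 0 < R)
    (G : EuclideanSpace ℝ (Fin d) → ℝ) (hG : Measurable G)
    (h : EuclideanSpace ℝ (Fin d) → ℝ) (hh : Measurable h)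
    (M : ℝ) (hM : ∀ y, |h y| ≤ M)
    (hsupp : ∀ y : EuclideanSpace ℝ (Fin d), R < ‖y‖ → h y = 0) :
    (∫⁻ x, ∫⁻ y, ENNReal.ofReal
        ((G (ε⁻¹ • x) - G (ε⁻¹ • y)) ^ 2 * (h y) ^ 2 * ‖x - y‖ ^ (-((d : ℝ) + 2 * s))))
      ≤ ENNReal.ofReal (ε ^ ((d : ℝ) - 2 * s) * M ^ 2) *
        ∫⁻ y in Metric.closedBall (0 : EuclideanSpace ℝ (Fin d)) (R / ε),
          ∫⁻ z, ENNReal.ofReal ((G (y + z) - G y) ^ 2 * ‖z‖ ^ (-((d : ℝ) + 2 * s))) := by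
  set p : ℝ := -((d : ℝ) + 2 * s) with hp
  set B := Metric.closedBall (0 : EuclideanSpace ℝ (Fin d)) (R / ε) with hB
  have hBm : MeasurableSet B := Metric.isClosed_closedBall.measurableSet
  let K : EuclideanSpace ℝ (Fin d) → EuclideanSpace ℝ (Fin d) → ℝ≥0∞ := fun u v =>
    B.indicator (fun v => ENNReal.ofReal ((G u - G v) ^ 2 * ‖u - v‖ ^ p)) v
  have hK : Measurable (Function.uncurry K) := by
    have hm : Measurable (fun q : EuclideanSpace ℝ (Fin d) × EuclideanSpace ℝ (Fin d) =>
        ENNReal.ofReal ((G q.1 - G q.2) ^ 2 * ‖q.1 - q.2‖ ^ p)) := by fun_prop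
    exact hm.indicator (measurable_snd hBm)
  have hpt : ∀ x y, ENNReal.ofReal
      ((G (ε⁻¹ • x) - G (ε⁻¹ • y)) ^ 2 * (h y) ^ 2 * ‖x - y‖ ^ p)
      ≤ ENNReal.ofReal (M ^ 2 * ε ^ p) * K (ε⁻¹ • x) (ε⁻¹ • y) := by
    intro x y
    by_cases hy : R < ‖y‖
    · simp [hsupp y hy]
    have hyB : ε⁻¹ • y ∈ B := by
      rw [hB, mem_closedBall_zero_iff, norm_smul, norm_inv, Real.norm_of_nonneg hε.le,
        inv_mul_eq_div]
      gcongr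
      exact not_lt.1 hy
    have hnorm : ‖x - y‖ ^ p = ε ^ p * ‖ε⁻¹ • x - ε⁻¹ • y‖ ^ p := by
      rw [← Real.mul_rpow hε.le (norm_nonneg _), ← smul_sub, norm_smul, norm_inv,
        Real.norm_of_nonneg hε.le, mul_inv_cancel_left₀ hε.ne']
    have hsq : h y ^ 2 ≤ M ^ 2 := sq_le_sq' (abs_le.1 (hM y)).1 (abs_le.1 (hM y)).2
    simp only [K, Set.indicator_of_mem hyB]
    rw [← ENNReal.ofReal_mul (by positivity), hnorm]
    apply ENNReal.ofReal_le_ofReal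
    calc _ = h y ^ 2 * (ε ^ p * ((G (ε⁻¹ • x) - G (ε⁻¹ • y)) ^ 2
          * ‖ε⁻¹ • x - ε⁻¹ • y‖ ^ p)) := by ring
      _ ≤ M ^ 2 * (ε ^ p * ((G (ε⁻¹ • x) - G (ε⁻¹ • y)) ^ 2
          * ‖ε⁻¹ • x - ε⁻¹ • y‖ ^ p)) := by gcongr
      _ = _ := by ring
  have hshift : ∀ v, ∫⁻ u, K u v = B.indicator (fun v =>
      ∫⁻ z, ENNReal.ofReal ((G (v + z) - G v) ^ 2 * ‖z‖ ^ p)) v := by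
    intro v
    rw [← lintegral_add_left_eq_self (fun u => K u v) v]
    by_cases hv : v ∈ B <;> simp [K, hv]
  have hconst : ENNReal.ofReal (M ^ 2 * ε ^ p) *
      (ENNReal.ofReal (ε ^ d) * ENNReal.ofReal (ε ^ d))
      = ENNReal.ofReal (ε ^ ((d : ℝ) - 2 * s) * M ^ 2) := by
    rw [← ENNReal.ofReal_mul (by positivity), ← ENNReal.ofReal_mul (by positivity)]
    congr 1
    have hexp : (d : ℝ) - 2 * s = p + d + d := by rw [hp]; ring
    rw [hexp, Real.rpow_add hε, Real.rpow_add hε, Real.rpow_natCast]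
    ring
  calc _ ≤ ∫⁻ x, ∫⁻ y, ENNReal.ofReal (M ^ 2 * ε ^ p) * K (ε⁻¹ • x) (ε⁻¹ • y) :=
        lintegral_mono fun x => lintegral_mono fun y => hpt x y
    _ = ENNReal.ofReal (M ^ 2 * ε ^ p) *
        (ENNReal.ofReal (ε ^ d) * ENNReal.ofReal (ε ^ d)) * ∫⁻ u, ∫⁻ v, K u v := by
      simp_rw [lintegral_const_mul' _ _ ENNReal.ofReal_ne_top,
        lintegral_comp_inv_smul hε (K _), lintegral_const_mul' _ _ ENNReal.ofReal_ne_top]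
      rw [lintegral_comp_inv_smul hε (fun u => ∫⁻ v, K u v)]
      ring
    _ = _ := by
      rw [hconst, lintegral_lintegral_swap hK.aemeasurable]
      simp_rw [hshift]
      rw [lintegral_indicator hBm]
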